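/- For every integer n ≥ 1, the identity 𝔉_{n,n−1}(2) = Σ_{s=0}^{n−1} C(n,s)·2^{n−1−s} = n·C_n holds; equivalently, specializing d = 2 in the formula (d−1)·(𝔉_{n,n−1}(d) − 1) + d·C_n for dim 𝒯(d,n) yields (n+2)·C_n − 1, the dimension of the Temperley–Lieb algebra of type B_n. -/

import Mathlib

/-- The `n`-th Catalan number `C_n = binom(2n,n)/(n+1)`. -/
def catalanNum (n : ℕ) : ℕ := (2 * n).choose n / (n + 1)

/-- The Catalan triangle entry `C(n,k) = (n+k)!·(n−k+1)/(k!·(n+1)!)`. -/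
def catalanTri (n k : ℕ) : ℕ :=
  ((n + k).factorial * (n - k + 1)) / (k.factorial * (n + 1).factorial)

/-- The Catalan triangle polynomial `𝔉_{n,k}(x) = Σ_{s=0}^k C(n,s)·x^{k−s}`. -/
def catalanTriPoly (n k x : ℕ) : ℕ :=
  ∑ s ∈ Finset.range (k + 1), catalanTri n s * x ^ (k - s)

theorem catalanTri_zero_right (n : ℕ) : catalanTri n 0 = 1 := by
  have h : n.factorial * (n + 1) = (n + 1).factorial := by
    rw [Nat.factorial_succ, mul_comm]
  simp [catalanTri, h, Nat.div_self (Nat.factorial_pos _)]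

theorem catalanTri_succ_add_choose {n k : ℕ} (h : k < n) :
    catalanTri n (k + 1) + (n + k + 1).choose k = (n + k + 1).choose (k + 1) := by
  obtain ⟨m, rfl⟩ := Nat.exists_eq_add_of_lt h
  set N := k + m + 1 + k + 1 with hN
  have ha : N.choose k * k.factorial * (k + m + 2).factorial = N.factorial := by
    have := Nat.choose_mul_factorial_mul_factorial (show k ≤ N by omega)
    rwa [show N - k = k + m + 2 by omega] at this
  have hb : N.choose (k + 1) * (k + 1).factorial * (k + m + 1).factorial = N.factorial := by
    have := Nat.choose_mul_factorial_mul_factorial (show k + 1 ≤ N by omega)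
    rwa [show N - (k + 1) = k + m + 1 by omega] at this
  have hpos : 0 < (k + 1).factorial * (k + m + 2).factorial := by positivity
  have hsum : (k + 1).factorial * (k + m + 2).factorial * N.choose (k + 1) =
      N.factorial * (m + 1) +
        (k + 1).factorial * (k + m + 2).factorial * N.choose k := by
    have h₁ : (k + 1).factorial * (k + m + 2).factorial * N.choose (k + 1) =
        (k + m + 2) * N.factorial := by
      rw [← hb, Nat.factorial_succ (k + m + 1)]; ring
    have h₂ : (k + 1).factorial * (k + m + 2).factorial * N.choose k =
        (k + 1) * N.factorial := by
      rw [← ha, Nat.factorial_succ k]; ring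
    rw [h₁, h₂]; ring
  have htri : catalanTri (k + m + 1) (k + 1) =
      N.factorial * (m + 1) / ((k + 1).factorial * (k + m + 2).factorial) := by
    rw [catalanTri, show k + m + 1 - (k + 1) + 1 = m + 1 by omega,
      show k + m + 1 + (k + 1) = N by omega]
  rw [htri, ← Nat.add_mul_div_left _ _ hpos, ← hsum, Nat.mul_div_cancel_left _ hpos]

theorem catalanTriPoly_succ (n k x : ℕ) :
    catalanTriPoly n (k + 1) x = catalanTriPoly n k x * x + catalanTri n (k + 1) := by
  rw [catalanTriPoly, Finset.sum_range_succ, catalanTriPoly, Finset.sum_mul, Nat.sub_self,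
    pow_zero, mul_one]
  congr 1
  refine Finset.sum_congr rfl fun s hs => ?_
  rw [Nat.succ_sub (Nat.lt_succ_iff.mp (Finset.mem_range.mp hs)), pow_succ, mul_assoc]

theorem catalanTriPoly_two_eq_choose {n k : ℕ} (h : k ≤ n) :
    catalanTriPoly n k 2 = (n + k + 1).choose k := by
  induction k with
  | zero => simp [catalanTriPoly, catalanTri_zero_right]
  | succ k ih =>
    have htri := catalanTri_succ_add_choose h
    have hpascal := Nat.choose_succ_succ' (n + k + 1) k
    rw [catalanTriPoly_succ, ih (by omega), ← add_assoc, hpascal]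
    omega

theorem succ_mul_catalanNum (n : ℕ) : (n + 1) * catalanNum n = (2 * n).choose n :=
  Nat.mul_div_cancel' (Nat.succ_dvd_centralBinom n)

theorem choose_pred_eq_mul_catalanNum {n : ℕ} (hn : 1 ≤ n) :
    (2 * n).choose (n - 1) = n * catalanNum n := by
  obtain ⟨m, rfl⟩ := Nat.exists_eq_add_of_le' hn
  have h := Nat.choose_succ_right_eq (2 * (m + 1)) m
  rw [← succ_mul_catalanNum (m + 1), show 2 * (m + 1) - m = m + 1 + 1 by omega] at h
  rw [Nat.add_sub_cancel]
  refine Nat.eq_of_mul_eq_mul_right (show 0 < m + 1 + 1 by omega) ?_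
  rw [← h]; ring

theorem catalanNum_pos (n : ℕ) : 0 < catalanNum n := by
  refine Nat.pos_of_mul_pos_left (a := n + 1) ?_
  rw [succ_mul_catalanNum]
  exact Nat.centralBinom_pos n

/-- For `n ≥ 1`, `𝔉_{n,n−1}(2) = Σ_{s=0}^{n−1} C(n,s)·2^{n−1−s} = n·C_n`; equivalently,
specializing `d = 2` in `(d−1)·(𝔉_{n,n−1}(d) − 1) + d·C_n` yields `(n+2)·C_n − 1`. -/
theorem catalanTriPoly_two (n : ℕ) (hn : 1 ≤ n) :
    catalanTriPoly n (n - 1) 2 = n * catalanNum n ∧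
    (∑ s ∈ Finset.range n, catalanTri n s * 2 ^ (n - 1 - s)) = n * catalanNum n ∧
    (2 - 1) * (catalanTriPoly n (n - 1) 2 - 1) + 2 * catalanNum n =
      (n + 2) * catalanNum n - 1 := by
  have hmain : catalanTriPoly n (n - 1) 2 = n * catalanNum n := by
    rw [catalanTriPoly_two_eq_choose (Nat.sub_le n 1),
      show n + (n - 1) + 1 = 2 * n by omega, choose_pred_eq_mul_catalanNum hn]
  refine ⟨hmain, ?_, ?_⟩
  · rw [← hmain, catalanTriPoly, Nat.sub_add_cancel hn]
  · have hpos : 0 < n * catalanNum n := Nat.mul_pos hn (catalanNum_pos n)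
    rw [hmain, add_mul]
    omega
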